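/- Normalization check for the overshoot law: for d ≥ 2, 0 < α < 2, x ∈ ℝ^d with x₁ > r, the integral ∫_{\{z : z₁ < r\}} C_{α,d} |x - z|^{-d} |r - x₁|^{α/2} |r - z₁|^{-α/2} dz = 1, where C_{α,d} = π^{-(d/2+1)} Γ(d/2) sin(απ/2). -/

import Mathlib

open MeasureTheory Real


lemma gam {s b : ℝ} (hs : 0 < s) (hb : 0 < b) :
    ∫⁻ t in Set.Ioi (0:ℝ), ENNReal.ofReal (t ^ (s-1) * rexp (-(b * t)))
      = ENNReal.ofReal (Real.Gamma s * b ^ (-s)) := by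
  have h := Real.integral_rpow_mul_exp_neg_mul_Ioi hs hb
  have e : (1 / b) ^ s * Real.Gamma s = Real.Gamma s * b ^ (-s) := by
    rw [one_div, Real.inv_rpow hb.le, Real.rpow_neg hb.le, mul_comm]
  rw [e] at h
  have hpos : 0 < Real.Gamma s * b ^ (-s) := mul_pos (Real.Gamma_pos_of_pos hs) (by positivity)
  rw [← h, ofReal_integral_eq_lintegral_ofReal]
  · exact Integrable.of_integral_ne_zero (by rw [h]; exact hpos.ne')
  · filter_upwards [ae_restrict_mem measurableSet_Ioi] with t ht
    have : (0:ℝ) < t := ht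
    simp only [Pi.zero_apply]; positivity

lemma gauss (n : ℕ) (c : Fin n → ℝ) {t : ℝ} (ht : 0 < t) :
    ∫⁻ y : Fin n → ℝ, ENNReal.ofReal (rexp (-(t * ∑ i, (c i - y i) ^ 2)))
      = ENNReal.ofReal ((π / t) ^ ((n:ℝ) / 2)) := by
  have h : ∫ y : Fin n → ℝ, rexp (-(t * ∑ i, (c i - y i) ^ 2)) = (π / t) ^ ((n:ℝ) / 2) := by
    have : ∀ y : Fin n → ℝ, rexp (-(t * ∑ i, (c i - y i) ^ 2))
        = ∏ i, (fun (i : Fin n) (w : ℝ) => rexp (-t * (c i - w) ^ 2)) i (y i) := by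
      intro y
      rw [← Real.exp_sum, ← Finset.mul_sum, neg_mul]
    simp_rw [this]
    rw [integral_fintype_prod_volume_eq_prod (fun (i : Fin n) (w : ℝ) => rexp (-t * (c i - w) ^ 2))]
    have : ∀ i, ∫ w, rexp (-t * (c i - w) ^ 2) = √(π / t) := by
      intro i
      rw [integral_sub_left_eq_self (fun w => rexp (-t * w ^ 2)), integral_gaussian]
    simp_rw [this]
    rw [Finset.prod_const, Finset.card_univ, Fintype.card_fin, Real.sqrt_eq_rpow,
      ← Real.rpow_natCast, ← Real.rpow_mul (by positivity)]
    congr 1; ring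
  have hpos : 0 < (π / t) ^ ((n:ℝ) / 2) := by positivity
  rw [← h, ofReal_integral_eq_lintegral_ofReal]
  · exact Integrable.of_integral_ne_zero (by rw [h]; exact hpos.ne')
  · exact Filter.Eventually.of_forall fun y => (Real.exp_pos _).le

lemma lemA (n : ℕ) (c : Fin n → ℝ) {u : ℝ} (hu : 0 < u) :
    ENNReal.ofReal (Real.Gamma (((n:ℝ)+1)/2)) *
    ∫⁻ y : Fin n → ℝ, ENNReal.ofReal ((u ^ 2 + ∑ i, (c i - y i) ^ 2) ^ (-(((n:ℝ)+1)/2)))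
      = ENNReal.ofReal (π ^ (((n:ℝ)+1)/2) * u⁻¹) := by
  have hs : 0 < ((n:ℝ)+1)/2 := by positivity
  have hG := Real.Gamma_pos_of_pos hs
  rw [← lintegral_const_mul _ (by fun_prop)]
  have : ∀ y : Fin n → ℝ, ENNReal.ofReal (Real.Gamma (((n:ℝ)+1)/2)) *
      ENNReal.ofReal ((u ^ 2 + ∑ i, (c i - y i) ^ 2) ^ (-(((n:ℝ)+1)/2))) =
      ∫⁻ t in Set.Ioi (0:ℝ), ENNReal.ofReal (t ^ (((n:ℝ)+1)/2-1) *
        rexp (-((u ^ 2 + ∑ i, (c i - y i) ^ 2) * t))) := by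
    intro y
    have : 0 < u ^ 2 + ∑ i, (c i - y i) ^ 2 := by positivity
    rw [gam hs this, ENNReal.ofReal_mul hG.le]
  simp_rw [this]
  rw [lintegral_lintegral_swap (by fun_prop)]
  have : ∀ t ∈ Set.Ioi (0:ℝ), ∫⁻ y : Fin n → ℝ, ENNReal.ofReal (t ^ (((n:ℝ)+1)/2-1) *
        rexp (-((u ^ 2 + ∑ i, (c i - y i) ^ 2) * t)))
      = ENNReal.ofReal (π ^ ((n:ℝ)/2)) *
        ENNReal.ofReal (t ^ ((1/2:ℝ)-1) * rexp (-(u ^ 2 * t))) := by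
    intro t ht
    have ht : 0 < t := ht
    have e : ∀ y : Fin n → ℝ, ENNReal.ofReal (t ^ (((n:ℝ)+1)/2-1) *
        rexp (-((u ^ 2 + ∑ i, (c i - y i) ^ 2) * t))) =
        ENNReal.ofReal (t ^ (((n:ℝ)+1)/2-1) * rexp (-(u ^ 2 * t))) *
        ENNReal.ofReal (rexp (-(t * ∑ i, (c i - y i) ^ 2))) := by
      intro y
      rw [← ENNReal.ofReal_mul (by positivity), mul_assoc, ← Real.exp_add]
      congr 3; ring
    simp_rw [e]
    rw [lintegral_const_mul _ (by fun_prop), gauss n c ht, ← ENNReal.ofReal_mul (by positivity),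
      ← ENNReal.ofReal_mul (by positivity)]
    congr 1
    rw [Real.div_rpow pi_pos.le ht.le, 
      show t ^ (((n:ℝ)+1)/2-1) = t ^ ((1/2:ℝ)-1) * t ^ ((n:ℝ)/2) by
        rw [← Real.rpow_add ht]; congr 1; ring]
    have : 0 < t ^ ((n:ℝ)/2) := by positivity
    field_simp
  rw [setLIntegral_congr_fun measurableSet_Ioi this, lintegral_const_mul _ (by fun_prop),
    gam (by norm_num) (by positivity), ← ENNReal.ofReal_mul (by positivity)]
  congr 1
  rw [Real.Gamma_one_half_eq, Real.sqrt_eq_rpow, ← mul_assoc, ← Real.rpow_add pi_pos,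
    ← Real.rpow_natCast, ← Real.rpow_mul hu.le]
  congr 1
  · congr 1; ring
  · rw [← Real.rpow_neg_one]; norm_num

lemma lemB {a β : ℝ} (ha : 0 < a) (h0 : 0 < β) (h1 : β < 1) :
    ∫⁻ s in Set.Ioi (0:ℝ), ENNReal.ofReal (s ^ (-β) * (a + s)⁻¹)
      = ENNReal.ofReal (π / Real.sin (π * β) * a ^ (-β)) := by
  have : ∀ s ∈ Set.Ioi (0:ℝ), ENNReal.ofReal (s ^ (-β) * (a + s)⁻¹) =
      ∫⁻ t in Set.Ioi (0:ℝ), ENNReal.ofReal (s ^ (-β) * rexp (-((a + s) * t))) := by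
    intro s hs
    have hs : 0 < s := hs
    have h := gam (s := 1) (b := a + s) one_pos (by positivity)
    simp only [sub_self, Real.rpow_zero, one_mul, Real.Gamma_one, Real.rpow_neg_one] at h
    rw [ENNReal.ofReal_mul (by positivity), ← h, ← lintegral_const_mul _ (by fun_prop)]
    simp_rw [ENNReal.ofReal_mul (show 0 ≤ s ^ (-β) by positivity)]
  rw [setLIntegral_congr_fun measurableSet_Ioi this, lintegral_lintegral_swap (by fun_prop)]
  have : ∀ t ∈ Set.Ioi (0:ℝ), 
      ∫⁻ s in Set.Ioi (0:ℝ), ENNReal.ofReal (s ^ (-β) * rexp (-((a + s) * t)))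
      = ENNReal.ofReal (Real.Gamma (1-β)) * ENNReal.ofReal (t ^ (β-1) * rexp (-(a * t))) := by
    intro t ht
    have ht : 0 < t := ht
    have h := gam (s := 1-β) (b := t) (by linarith) ht
    have hG := Real.Gamma_pos_of_pos (s := 1-β) (by linarith)
    have e : ∀ s : ℝ, ENNReal.ofReal (s ^ (-β) * rexp (-((a + s) * t))) =
       ENNReal.ofReal (rexp (-(a * t))) * ENNReal.ofReal (s ^ (1-β-1) * rexp (-(t * s))) := by
      intro s
      rw [← ENNReal.ofReal_mul (by positivity)]
      congr 1
      rw [show (1-β-1) = -β by ring, show -((a + s) * t) = -(a*t) + -(t*s) by ring, Real.exp_add]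
      ring
    simp_rw [e]
    rw [lintegral_const_mul _ (by fun_prop), h, ← ENNReal.ofReal_mul (by positivity),
      ← ENNReal.ofReal_mul hG.le]
    congr 1
    rw [neg_sub]; ring
  have hG := Real.Gamma_pos_of_pos (s := 1-β) (by linarith)
  rw [setLIntegral_congr_fun measurableSet_Ioi this, lintegral_const_mul _ (by fun_prop),
    gam h0 ha, ← ENNReal.ofReal_mul hG.le, ← Real.Gamma_mul_Gamma_one_sub]
  congr 1; ring

theorem overshoot_law_normalisation
    (d : ℕ) (hd : 2 ≤ d) (hd0 : 0 < d) (α r : ℝ) (hα : 0 < α) (hα2 : α < 2)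
    (x : EuclideanSpace ℝ (Fin d)) (hx : r < x ⟨0, hd0⟩) :
    ∫ z in {z : EuclideanSpace ℝ (Fin d) | z ⟨0, hd0⟩ < r},
        π ^ (-((d : ℝ) / 2 + 1)) * Real.Gamma ((d : ℝ) / 2) * Real.sin (α * π / 2) *
          ‖x - z‖ ^ (-(d : ℝ)) * |r - x ⟨0, hd0⟩| ^ (α / 2) *
          |r - z ⟨0, hd0⟩| ^ (-(α / 2)) = 1 := by
  obtain ⟨n, rfl⟩ : ∃ n, d = n + 1 := ⟨d - 1, by omega⟩
  have h0 : (⟨0, hd0⟩ : Fin (n+1)) = 0 := rfl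
  simp only [h0] at hx ⊢
  push_cast
  have hsin : 0 < Real.sin (α * π / 2) := by
    apply Real.sin_pos_of_pos_of_lt_pi
    · positivity
    · nlinarith [pi_pos]
  have hs : 0 < ((n:ℝ)+1)/2 := by positivity
  have hG := Real.Gamma_pos_of_pos hs
  have ha : 0 < x 0 - r := by linarith
  have hS : MeasurableSet {z : EuclideanSpace ℝ (Fin (n+1)) | z 0 < r} :=
    measurableSet_lt (by fun_prop) measurable_const
  rw [integral_eq_lintegral_of_nonneg_ae
    (Filter.Eventually.of_forall fun z => by simp only [Pi.zero_apply]; positivity)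
    (Measurable.aestronglyMeasurable (by fun_prop))]
  set A : ℝ := π ^ (-(((n:ℝ)+1) / 2 + 1)) * Real.sin (α * π / 2) * (x 0 - r) ^ (α / 2) with hA
  have hA0 : 0 ≤ A := by positivity
  let g : ℝ → ENNReal := fun w => (Set.Iio r).indicator 1 w * ENNReal.ofReal (A * |r - w| ^ (-(α / 2)))
  let c : Fin n → ℝ := fun i => x i.succ
  let F : ℝ × (Fin n → ℝ) → ENNReal := fun p => g p.1 * (ENNReal.ofReal (Real.Gamma (((n:ℝ)+1)/2)) *
    ENNReal.ofReal (((x 0 - p.1) ^ 2 + ∑ i, (c i - p.2 i) ^ 2) ^ (-(((n:ℝ)+1)/2))))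
  have hg : Measurable g :=
    (measurable_one.indicator measurableSet_Iio).mul (by fun_prop)
  have hF : Measurable F := (hg.comp measurable_fst).mul (by fun_prop)
  have key : ∫⁻ p, F p = 1 := by
    rw [Measure.volume_eq_prod, lintegral_prod _ hF.aemeasurable]
    have : ∀ w, ∫⁻ y, F (w, y) =
      (fun s => ENNReal.ofReal (A * π ^ (((n:ℝ)+1)/2)) * (Set.Ioi (0:ℝ)).indicator
        (fun s => ENNReal.ofReal (s ^ (-(α/2)) * ((x 0 - r) + s)⁻¹)) s) (r - w) := by
      intro w
      simp only [F]
      by_cases hw : w < r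
      · rw [lintegral_const_mul _ (by fun_prop), lintegral_const_mul _ (by fun_prop),
          lemA n c (by linarith : 0 < x 0 - w)]
        have hw' : 0 < r - w := by linarith
        simp only [g]
        rw [Set.indicator_of_mem (by exact hw), Set.indicator_of_mem (by exact hw'),
          Pi.one_apply, one_mul, ← ENNReal.ofReal_mul (by positivity),
          ← ENNReal.ofReal_mul (by positivity), abs_of_pos hw',
          show x 0 - r + (r - w) = x 0 - w by ring]
        congr 1; ring
      · have hg0 : g w = 0 := by simp [g, hw]
        have hw' : ¬ (0 < r - w) := by linarith
        simp [hg0, hw']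
    simp_rw [this]
    rw [lintegral_sub_left_eq_self (fun s => ENNReal.ofReal (A * π ^ (((n:ℝ)+1)/2)) *
        (Set.Ioi (0:ℝ)).indicator
        (fun s => ENNReal.ofReal (s ^ (-(α/2)) * ((x 0 - r) + s)⁻¹)) s) r,
      lintegral_const_mul _ (Measurable.indicator (by fun_prop) measurableSet_Ioi),
      lintegral_indicator measurableSet_Ioi, lemB ha (by linarith) (by linarith),
      ← ENNReal.ofReal_mul (by positivity), ← ENNReal.ofReal_one]
    congr 1
    rw [hA, neg_add, Real.rpow_add pi_pos, Real.rpow_neg pi_pos.le, Real.rpow_neg_one,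
      Real.rpow_neg ha.le, show π * (α/2) = α * π / 2 by ring]
    have h1 : 0 < (x 0 - r) ^ (α/2) := by positivity
    have h2 : 0 < π ^ (((n:ℝ)+1)/2) := by positivity
    generalize Real.sin (α * π / 2) = S at hsin
    field_simp
  have e1 := (PiLp.volume_preserving_ofLp (Fin (n+1))).lintegral_comp_emb
    (MeasurableEquiv.toLp 2 (Fin (n+1) → ℝ)).symm.measurableEmbedding
  have e2 := (volume_preserving_piFinSuccAbove (fun _ : Fin (n+1) => ℝ) 0).lintegral_comp hF
  have e3 := e1 (fun z => F (MeasurableEquiv.piFinSuccAbove (fun _ : Fin (n+1) => ℝ) 0 z))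
  rw [← lintegral_indicator hS]
  rw [e2, key] at e3
  refine Eq.trans ?_ ((congrArg ENNReal.toReal e3).trans ENNReal.toReal_one)
  congr 2
  funext z
  have hQ : ‖x - z‖ ^ (-((n:ℝ)+1)) =
      ((x 0 - z 0) ^ 2 + ∑ i : Fin n, (x i.succ - z i.succ) ^ 2) ^ (-(((n:ℝ)+1)/2)) := by
    rw [EuclideanSpace.norm_eq, Real.sqrt_eq_rpow, ← Real.rpow_mul (by positivity),
      Fin.sum_univ_succ]
    simp only [PiLp.sub_apply, Real.norm_eq_abs, sq_abs]
    congr 1; ring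
  have hF' : F (MeasurableEquiv.piFinSuccAbove (fun _ : Fin (n+1) => ℝ) 0 z.ofLp) =
     g (z 0) * (ENNReal.ofReal (Real.Gamma (((n:ℝ)+1)/2)) *
    ENNReal.ofReal (((x 0 - z 0) ^ 2 + ∑ i : Fin n, (x i.succ - z i.succ) ^ 2) ^ (-(((n:ℝ)+1)/2)))) := rfl
  rw [hF', ← hQ]
  by_cases hw : z 0 < r
  · rw [Set.indicator_of_mem (by exact hw)]
    simp only [g]
    rw [Set.indicator_of_mem (by exact hw), Pi.one_apply, one_mul, 
      ← ENNReal.ofReal_mul hG.le, ← ENNReal.ofReal_mul (by positivity), hA,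
      abs_sub_comm r (x 0), abs_of_pos ha]
    congr 1; ring
  · rw [Set.indicator_of_notMem (by exact hw)]
    simp [g, hw]
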